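/- arXiv:1511.07310 — 2 statements merged into one kernel-verified Lean document; each statement's English description precedes it below -/
import Mathlib

section
/- Let G be a finite simple graph and let x_1 and x_2 be two leaves of G belonging to vertex-disjoint edges (so their unique neighbours y_1 and y_2 are distinct and the edges x_1y_1 and x_2y_2 share no vertex). Let Ġ be the graph obtained from G by identifying x_1 and x_2 into a single vertex. Then ara I(Ġ) ≤ ara I(G). -/
open SimpleGraph

variable {V : Type}

/-- `C` is a vertex cover of `G`: every edge of `G` has an endpoint in `C`. -/
def IsVC (G : SimpleGraph V) (C : Set V) : Prop :=
  ∀ ⦃u v : V⦄, G.Adj u v → u ∈ C ∨ v ∈ C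

/-- `C` is a minimal vertex cover of `G`. -/
def IsMinVC (G : SimpleGraph V) (C : Set V) : Prop :=
  IsVC G C ∧ ∀ D : Set V, D ⊂ C → ¬ IsVC G D

/-- `C` is a maximum minimal vertex cover of `G`: a minimal vertex cover of
maximal cardinality among minimal vertex covers. -/
def IsMaxMinVC (G : SimpleGraph V) (C : Set V) : Prop :=
  IsMinVC G C ∧ ∀ D : Set V, IsMinVC G D → D.ncard ≤ C.ncard

/-- The big height of the edge ideal of `G`: the maximum cardinality of a
minimal vertex cover of `G`. -/
noncomputable def bight (G : SimpleGraph V) : ℕ :=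
  sSup {n : ℕ | ∃ C : Set V, IsMinVC G C ∧ C.ncard = n}

/-- The edge ideal of `G` in the polynomial ring `k[x_v : v ∈ V]`. -/
noncomputable def edgeIdeal (k : Type) [Field k] (G : SimpleGraph V) :
    Ideal (MvPolynomial V k) :=
  Ideal.span {p : MvPolynomial V k |
    ∃ u v : V, G.Adj u v ∧ p = MvPolynomial.X u * MvPolynomial.X v}

/-- The arithmetical rank of the edge ideal of `G`: the least `r` such that
there are `r` polynomials generating an ideal whose radical is `I(G)`. -/
noncomputable def ara (k : Type) [Field k] (G : SimpleGraph V) : ℕ :=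
  sInf {r : ℕ | ∃ q : Fin r → MvPolynomial V k,
    (Ideal.span (Set.range q)).radical = edgeIdeal k G}

theorem edgeIdeal_radical {V : Type} (k : Type) [Field k] (G : SimpleGraph V) :
    (edgeIdeal k G).radical = edgeIdeal k G := by
  classical
  refine le_antisymm ?_ Ideal.le_radical
  rintro p ⟨n, hn⟩
  have hI : edgeIdeal k G = Ideal.span ((fun s => MvPolynomial.monomial s (1 : k)) ''
      {s : V →₀ ℕ | ∃ u v, G.Adj u v ∧ s = Finsupp.single u 1 + Finsupp.single v 1}) := by
    unfold edgeIdeal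
    congr 1
    ext q
    constructor
    · rintro ⟨u, v, h, rfl⟩
      exact ⟨_, ⟨u, v, h, rfl⟩, by simp [MvPolynomial.X, MvPolynomial.monomial_mul]⟩
    · rintro ⟨_, ⟨u, v, h, rfl⟩, rfl⟩
      exact ⟨u, v, h, by simp [MvPolynomial.X, MvPolynomial.monomial_mul]⟩
  rw [hI, MvPolynomial.mem_ideal_span_monomial_image]
  intro m hm
  by_contra hcon
  have hcov : ∀ u v, G.Adj u v → m u = 0 ∨ m v = 0 := by
    intro u v huv
    by_contra! h
    refine hcon ⟨_, ⟨u, v, huv, rfl⟩, ?_⟩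
    intro w
    have hne : u ≠ v := huv.ne
    by_cases h1 : u = w
    · subst h1
      simp [hne.symm]
      omega
    · by_cases h2 : v = w
      · subst h2
        simp [h1]
        omega
      · simp [h1, h2]
  let ψ : MvPolynomial V k →ₐ[k] MvPolynomial V k :=
    MvPolynomial.aeval (fun v => if m v = 0 then 0 else MvPolynomial.X v)
  let J : Ideal (MvPolynomial V k) := Ideal.span (MvPolynomial.X '' {v | m v = 0})
  have hJ : (Ideal.Quotient.mkₐ k J).comp ψ = Ideal.Quotient.mkₐ k J := by
    apply MvPolynomial.algHom_ext
    intro v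
    by_cases hv : m v = 0
    · have : (MvPolynomial.X v : MvPolynomial V k) ∈ J :=
        Ideal.subset_span ⟨v, hv, rfl⟩
      simp only [AlgHom.comp_apply, ψ, MvPolynomial.aeval_X, hv, if_true, map_zero]
      exact (Ideal.Quotient.eq_zero_iff_mem.mpr this).symm
    · simp [ψ, hv]
  have hker : edgeIdeal k G ≤ RingHom.ker ψ := by
    unfold edgeIdeal
    rw [Ideal.span_le]
    rintro _ ⟨u, v, h, rfl⟩
    rcases hcov u v h with h | h <;> simp [ψ, RingHom.mem_ker, h]
  have h0 : ψ p = 0 := by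
    have := hker hn
    rw [RingHom.mem_ker, map_pow] at this
    exact eq_zero_of_pow_eq_zero this
  have hpJ : p ∈ J := by
    have := congrArg (fun f => f p) hJ
    simp only [AlgHom.comp_apply, h0, map_zero] at this
    exact Ideal.Quotient.eq_zero_iff_mem.mp this.symm
  obtain ⟨i, hi, hi'⟩ := MvPolynomial.mem_ideal_span_X_image.mp hpJ m hm
  exact hi' hi

/-- Identifying two leaves `x₁, x₂` of `G` lying on vertex-disjoint edges
(`Gdot` is `G` with the edge `x₂y₂` replaced by `x₁y₂`, the identified vertex
being `x₁`, and `x₂` becoming isolated) does not increase the arithmetical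
rank of the edge ideal. -/
theorem stmt3 {V : Type} [Fintype V] (k : Type) [Field k]
    (G Gdot : SimpleGraph V) (x₁ x₂ y₁ y₂ : V)
    (hleaf₁ : G.neighborSet x₁ = {y₁}) (hleaf₂ : G.neighborSet x₂ = {y₂})
    (hx : x₁ ≠ x₂) (hy : y₁ ≠ y₂) (hxy₁ : x₁ ≠ y₂) (hxy₂ : x₂ ≠ y₁)
    (hdot : ∀ u v : V, Gdot.Adj u v ↔
      ((G.Adj u v ∧ s(u, v) ≠ s(x₂, y₂)) ∨ s(u, v) = s(x₁, y₂))) :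
    ara k Gdot ≤ ara k G := by
  classical
  have hne : {r : ℕ | ∃ q : Fin r → MvPolynomial V k,
      (Ideal.span (Set.range q)).radical = edgeIdeal k G}.Nonempty := by
    obtain ⟨n, f, hf⟩ := Submodule.fg_iff_exists_fin_generating_family.mp
      (IsNoetherian.noetherian (edgeIdeal k G))
    refine ⟨n, f, ?_⟩
    have hf' : Ideal.span (Set.range f) = edgeIdeal k G := hf
    rw [hf', edgeIdeal_radical]
  obtain ⟨q, hq⟩ := Nat.sInf_mem hne
  unfold ara
  apply Nat.sInf_le
  let φ : MvPolynomial V k →ₐ[k] MvPolynomial V k :=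
    MvPolynomial.aeval (fun v => if v = x₂ then MvPolynomial.X x₁ else MvPolynomial.X v)
  have a₂ : ∀ v, G.Adj x₂ v → v = y₂ := fun v h => by
    have : v ∈ G.neighborSet x₂ := h
    rwa [hleaf₂] at this
  have b₂ : G.Adj x₂ y₂ := by
    have : y₂ ∈ G.neighborSet x₂ := by rw [hleaf₂]; rfl
    exact this
  have c₂ : y₂ ≠ x₂ := b₂.ne.symm
  have d : Gdot.Adj x₁ y₂ := (hdot _ _).mpr (Or.inr rfl)
  have hmap : (edgeIdeal k G).map φ = edgeIdeal k Gdot := by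
    apply le_antisymm
    · rw [Ideal.map_le_iff_le_comap]
      unfold edgeIdeal
      rw [Ideal.span_le]
      rintro _ ⟨u, v, h, rfl⟩
      apply Ideal.subset_span
      by_cases hu : u = x₂
      · subst hu
        obtain rfl := a₂ v h
        exact ⟨x₁, v, d, by simp [φ, c₂]⟩
      · by_cases hv : v = x₂
        · subst hv
          obtain rfl := a₂ u h.symm
          exact ⟨u, x₁, d.symm, by simp [φ, c₂]⟩
        · refine ⟨u, v, (hdot _ _).mpr (Or.inl ⟨h, ?_⟩), by simp [φ, hu, hv]⟩
          simp [hu, hv]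
    · conv_lhs => unfold edgeIdeal
      rw [Ideal.span_le]
      have key : (MvPolynomial.X x₁ * MvPolynomial.X y₂ : MvPolynomial V k) ∈
          (edgeIdeal k G).map φ := by
        have : φ (MvPolynomial.X x₂ * MvPolynomial.X y₂) ∈ (edgeIdeal k G).map φ :=
          Ideal.mem_map_of_mem _ (Ideal.subset_span ⟨x₂, y₂, b₂, rfl⟩)
        simpa [φ, c₂] using this
      rintro _ ⟨u, v, h, rfl⟩
      rcases (hdot u v).mp h with ⟨h, hs⟩ | h
      · have hu : u ≠ x₂ := by
          rintro rfl
          exact hs (by rw [a₂ v h])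
        have hv : v ≠ x₂ := by
          rintro rfl
          exact hs (by rw [a₂ u h.symm, Sym2.eq_swap])
        have : φ (MvPolynomial.X u * MvPolynomial.X v) ∈ (edgeIdeal k G).map φ :=
          Ideal.mem_map_of_mem _ (Ideal.subset_span ⟨u, v, h, rfl⟩)
        simpa [φ, hu, hv] using this
      · rcases Sym2.eq_iff.mp h with ⟨rfl, rfl⟩ | ⟨rfl, rfl⟩
        · exact key
        · rw [mul_comm]
          exact key
  refine ⟨fun i => φ (q i), ?_⟩
  have hspan : Ideal.span (Set.range fun i => φ (q i)) = (Ideal.span (Set.range q)).map φ := by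
    rw [Ideal.map_span, ← Set.range_comp]
    rfl
  rw [hspan]
  generalize Ideal.span (Set.range q) = K at hq
  apply le_antisymm
  · rw [← edgeIdeal_radical k Gdot, ← hmap, ← hq]
    exact Ideal.radical_mono (Ideal.map_mono Ideal.le_radical)
  · rw [← hmap, ← hq]
    exact Ideal.map_radical_le φ
end

section
/- Let G be a finite simple graph, x one of its vertices, and G' the graph obtained from G by attaching a whisker at x (adding a new vertex y and the edge xy). Then bight I(G) ≤ bight I(G') ≤ bight I(G) + 1, i.e., the maximum cardinality of a minimal vertex cover of G' is equal to, or one more than, the maximum cardinality of a minimal vertex cover of G. -/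
open SimpleGraph

variable {V : Type}

theorem isMinVC_iff (G : SimpleGraph V) (C : Set V) :
    IsMinVC G C ↔ IsVC G C ∧ ∀ v ∈ C, ∃ w, w ∉ C ∧ G.Adj v w := by
  constructor
  · rintro ⟨h, hm⟩
    refine ⟨h, fun v hv => ?_⟩
    by_contra hcon
    push Not at hcon
    refine hm (C \ {v}) ?_ ?_
    · refine ⟨Set.diff_subset, fun hs => ?_⟩
      exact (hs hv).2 rfl
    · intro a b hab
      have h1 := h hab
      have hne := hab.ne
      have h2 := hcon b
      have h3 := hcon a
      have hba := hab.symm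
      simp only [Set.mem_diff, Set.mem_singleton_iff]
      by_cases ha : a = v
      · subst ha
        right
        exact ⟨by by_contra hb; exact h2 hb hab, fun e => hne e.symm⟩
      · by_cases hb : b = v
        · subst hb
          left
          exact ⟨by by_contra hc; exact h3 hc hba, ha⟩
        · tauto
  · rintro ⟨h, hp⟩
    refine ⟨h, fun D hD hDc => ?_⟩
    obtain ⟨v, hv, hvD⟩ := Set.exists_of_ssubset hD
    obtain ⟨w, hw, hvw⟩ := hp v hv
    rcases hDc hvw with h1 | h1
    · exact hvD h1
    · exact hw (hD.1 h1)

theorem exists_minVC [Finite V] (G : SimpleGraph V) : ∃ C, IsMinVC G C := by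
  obtain ⟨C, hC⟩ := (Set.toFinite {C : Set V | IsVC G C}).exists_minimal
    ⟨Set.univ, fun _ _ _ => Or.inl trivial⟩
  exact ⟨C, hC.1, fun D hD hDc => hD.2 (hC.2 hDc hD.1)⟩

theorem le_bight [Finite V] (G : SimpleGraph V) (C : Set V) (h : IsMinVC G C) :
    C.ncard ≤ bight G := by
  refine le_csSup ⟨Nat.card V, ?_⟩ ⟨C, h, rfl⟩
  rintro n ⟨D, -, rfl⟩
  exact Set.ncard_le_card D

theorem bight_le [Finite V] (G : SimpleGraph V) (n : ℕ)
    (h : ∀ C, IsMinVC G C → C.ncard ≤ n) : bight G ≤ n := by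
  obtain ⟨C, hC⟩ := exists_minVC G
  refine csSup_le ⟨_, C, hC, rfl⟩ ?_
  rintro m ⟨D, hD, rfl⟩
  exact h D hD

/-- Attaching a whisker at a vertex `x` of `G` (adding a new vertex `y`,
isolated in `G`, and the edge `xy`) increases the big height by zero or one. -/
theorem stmt4 {V : Type} [Fintype V] (G : SimpleGraph V) (x y : V)
    (hxy : x ≠ y) (hy : y ∉ G.support) :
    bight G ≤ bight (G ⊔ SimpleGraph.fromEdgeSet {s(x, y)}) ∧
      bight (G ⊔ SimpleGraph.fromEdgeSet {s(x, y)}) ≤ bight G + 1 := by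
  have hadj : ∀ a b, (G ⊔ SimpleGraph.fromEdgeSet {s(x, y)}).Adj a b ↔
      G.Adj a b ∨ (a = x ∧ b = y) ∨ (a = y ∧ b = x) := by
    intro a b
    simp only [SimpleGraph.sup_adj, SimpleGraph.fromEdgeSet_adj, Set.mem_singleton_iff,
      Sym2.eq_iff]
    grind
  have hy1 : ∀ a, ¬ G.Adj y a := fun a h => hy ⟨a, h⟩
  have hy2 : ∀ a, ¬ G.Adj a y := fun a h => hy ⟨a, h.symm⟩
  generalize (G ⊔ SimpleGraph.fromEdgeSet {s(x, y)}) = G' at hadj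
  constructor
  · refine bight_le _ _ fun C hC => ?_
    rw [isMinVC_iff] at hC
    obtain ⟨h, hp⟩ := hC
    have hyC : y ∉ C := fun hc => by
      obtain ⟨w, -, hw⟩ := hp y hc
      exact hy1 w hw
    by_cases hx : x ∈ C
    · apply le_bight
      rw [isMinVC_iff]
      refine ⟨fun a b hab => ?_, fun v hv => ?_⟩
      · rw [hadj] at hab
        rcases hab with hab | ⟨rfl, rfl⟩ | ⟨rfl, rfl⟩
        · exact h hab
        · exact Or.inl hx
        · exact Or.inr hx
      · obtain ⟨w, hw, hvw⟩ := hp v hv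
        exact ⟨w, hw, (hadj _ _).2 (Or.inl hvw)⟩
    · refine (Set.ncard_le_ncard (Set.subset_insert y C)).trans (le_bight _ _ ?_)
      rw [isMinVC_iff]
      refine ⟨fun a b hab => ?_, fun v hv => ?_⟩
      · rw [hadj] at hab
        rcases hab with hab | ⟨rfl, rfl⟩ | ⟨rfl, rfl⟩
        · exact (h hab).imp Or.inr Or.inr
        · exact Or.inr (Or.inl rfl)
        · exact Or.inl (Or.inl rfl)
      · rcases hv with rfl | hv
        · refine ⟨x, ?_, (hadj _ _).2 (Or.inr (Or.inr ⟨rfl, rfl⟩))⟩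
          rintro (e | e)
          · exact hxy e
          · exact hx e
        · obtain ⟨w, hw, hvw⟩ := hp v hv
          refine ⟨w, ?_, (hadj _ _).2 (Or.inl hvw)⟩
          rintro (rfl | e)
          · exact hy2 _ hvw
          · exact hw e
  · refine bight_le _ _ fun C hC => ?_
    rw [isMinVC_iff] at hC
    obtain ⟨h, hp⟩ := hC
    have hG : IsVC G C := fun a b hab => h ((hadj _ _).2 (Or.inl hab))
    have key : ∀ z ∈ C, IsMinVC G (C \ {z}) → C.ncard ≤ bight G + 1 := by
      intro z hz hm
      have h1 := le_bight _ _ hm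
      have h2 := Set.ncard_diff_singleton_add_one hz
      omega
    have hcov : x ∈ C ∨ y ∈ C := h ((hadj _ _).2 (Or.inr (Or.inl ⟨rfl, rfl⟩)))
    have hpG : ∀ v ∈ C, v ≠ x → v ≠ y → ∃ w, w ∉ C ∧ G.Adj v w := by
      intro v hv h1 h2
      obtain ⟨w, hw, hvw⟩ := hp v hv
      rw [hadj] at hvw
      exact ⟨w, hw, by tauto⟩
    by_cases hyC : y ∈ C
    · have hx : x ∉ C := by
        obtain ⟨w, hw, hvw⟩ := hp y hyC
        rw [hadj] at hvw
        rcases hvw with hvw | ⟨e, -⟩ | ⟨-, rfl⟩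
        · exact absurd hvw (hy1 _)
        · exact absurd e.symm hxy
        · exact hw
      apply key y hyC
      rw [isMinVC_iff]
      refine ⟨fun a b hab => ?_, fun v hv => ?_⟩
      · refine (hG hab).imp (fun q => ⟨q, ?_⟩) (fun q => ⟨q, ?_⟩)
        · rintro rfl
          exact hy1 _ hab
        · rintro rfl
          exact hy2 _ hab
      · obtain ⟨w, hw, hvw⟩ := hpG v hv.1 (fun e => hx (e ▸ hv.1)) hv.2
        exact ⟨w, fun e => hw e.1, hvw⟩
    · have hx : x ∈ C := hcov.resolve_right hyC
      by_cases hpx : ∃ w, w ∉ C ∧ G.Adj x w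
      · refine (le_bight G C ?_).trans (Nat.le_succ _)
        rw [isMinVC_iff]
        refine ⟨hG, fun v hv => ?_⟩
        by_cases hvx : v = x
        · exact hvx ▸ hpx
        · exact hpG v hv hvx (fun e => hyC (e ▸ hv))
      · push Not at hpx
        apply key x hx
        rw [isMinVC_iff]
        refine ⟨fun a b hab => ?_, fun v hv => ?_⟩
        · have h1 := hG hab
          have h2 := hpx b
          have h3 := hpx a
          have hba := hab.symm
          have hne := hab.ne
          simp only [Set.mem_diff, Set.mem_singleton_iff]
          grind
        · obtain ⟨w, hw, hvw⟩ := hpG v hv.1 hv.2 (fun e => hyC (e ▸ hv.1))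
          exact ⟨w, fun e => hw e.1, hvw⟩
end
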